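/- Let $(M, g)$ be a smooth Riemannian manifold of dimension $2n+1$ with Levi-Civita connection $\nabla$ and Ricci tensor $S$, and let $(\varphi, \xi, \eta)$ be an almost contact metric structure on it, that is, a $(1,1)$-tensor field $\varphi$, a vector field $\xi$ and a 1-form $\eta$ with $\varphi^2 = -I + \eta\otimes\xi$, $\eta(\xi) = 1$, $\eta(X) = g(X,\xi)$ and $g(\varphi X, \varphi Y) = g(X,Y) - \eta(X)\eta(Y)$. Suppose that it is a Kenmotsu manifold: $(\nabla_X\varphi)Y = g(\varphi X, Y)\xi - \eta(Y)\varphi X$ for all vector fields $X, Y$. Let $(g, V, \lambda, \mu)$ be a conformal $\eta$-Ricci soliton on $M$ with conformal pressure $p$, that is, $V$ is a smooth vector field, $\lambda, \mu$ are real constants, $p$ is a scalar function on $M$, and $$\mathcal{L}_V g + 2S + \Big[2\lambda - \Big(p + \frac{2}{2n+1}\Big)\Big] g + 2\mu\, \eta\otimes\eta = 0.$$ If $\mathcal{L}_V\xi = \eta(\mathcal{L}_V\xi)\,\xi$, then for every smooth vector field $X$ $$(\mathcal{L}_V\eta)(X) = \Big[(2n - \lambda - \mu) + \Big(\frac{p}{2}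 + \frac{1}{2n+1}\Big)\Big]\eta(X).$$ -/

import Mathlib

open Bundle
open scoped Manifold ContDiff

noncomputable section

namespace RiemannianGeometry

variable {E : Type*} [NormedAddCommGroup E] [NormedSpace ℝ E] [FiniteDimensional ℝ E]
  {H : Type*} [TopologicalSpace H] {I : ModelWithCorners ℝ E H}
  {M : Type*} [TopologicalSpace M] [ChartedSpace H M] [IsManifold I ∞ M]
  [RiemannianBundle (fun x : M ↦ TangentSpace I x)]
  [IsContMDiffRiemannianBundle I ∞ E (fun x : M ↦ TangentSpace I x)]

theorem mdifferentiableAt_inner {X Y : Π x : M, TangentSpace I x} {x : M}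
    (hX : MDiffAt (T% X) x) (hY : MDiffAt (T% Y) x) :
    MDiffAt (fun y ↦ inner ℝ (X y) (Y y)) x :=
  MDifferentiableAt.inner_bundle (F := E) (E := fun x : M ↦ TangentSpace I x) (b := id) hX hY

/-- The right-hand side of the Koszul formula at `x`:
`X g(Y,Z) + Y g(Z,X) - Z g(X,Y) - g(X,[Y,Z]) + g(Y,[Z,X]) + g(Z,[X,Y])`. -/
def koszul (X Y Z : Π x : M, TangentSpace I x) (x : M) : ℝ :=
  mvfderiv I (fun y ↦ inner ℝ (Y y) (Z y)) x (X x)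
    + mvfderiv I (fun y ↦ inner ℝ (Z y) (X y)) x (Y x)
    - mvfderiv I (fun y ↦ inner ℝ (X y) (Y y)) x (Z x)
    - inner ℝ (X x) (VectorField.mlieBracket I Y Z x)
    + inner ℝ (Y x) (VectorField.mlieBracket I Z X x)
    + inner ℝ (Z x) (VectorField.mlieBracket I X Y x)

theorem koszul_tensorial_left {Y Z : Π x : M, TangentSpace I x} {x : M}
    (hY : MDiffAt (T% Y) x) (hZ : MDiffAt (T% Z) x) :
    TensorialAt I E (fun X ↦ koszul X Y Z x) x where
  smul {f X} hf hX := by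
    have hZX := mdifferentiableAt_inner hZ hX
    have hXY := mdifferentiableAt_inner hX hY
    have h1 : (fun y ↦ inner ℝ (Z y) ((f • X) y)) = f * fun y ↦ inner ℝ (Z y) (X y) := by
      ext y; simp [inner_smul_right]
    have h2 : (fun y ↦ inner ℝ ((f • X) y) (Y y)) = f * fun y ↦ inner ℝ (X y) (Y y) := by
      ext y; simp [inner_smul_left]
    simp only [koszul, h1, h2, mvfderiv_mul hf hZX, mvfderiv_mul hf hXY,
      VectorField.mlieBracket_smul_left hf hX, VectorField.mlieBracket_smul_right hf hX]
    simp [inner_add_right, inner_smul_right, inner_smul_left, real_inner_comm]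
    ring
  add {X X'} hX hX' := by
    have h1 : (fun y ↦ inner ℝ (Z y) ((X + X') y))
        = (fun y ↦ inner ℝ (Z y) (X y)) + fun y ↦ inner ℝ (Z y) (X' y) := by
      ext y; simp [inner_add_right]
    have h2 : (fun y ↦ inner ℝ ((X + X') y) (Y y))
        = (fun y ↦ inner ℝ (X y) (Y y)) + fun y ↦ inner ℝ (X' y) (Y y) := by
      ext y; simp [inner_add_left]
    simp only [koszul, h1, h2, mvfderiv_add (mdifferentiableAt_inner hZ hX) (mdifferentiableAt_inner hZ hX'),
      mvfderiv_add (mdifferentiableAt_inner hX hY) (mdifferentiableAt_inner hX' hY),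
      VectorField.mlieBracket_add_left hX hX', VectorField.mlieBracket_add_right hX hX']
    simp [inner_add_right, inner_add_left]
    ring

theorem koszul_tensorial_right {X Y : Π x : M, TangentSpace I x} {x : M}
    (hX : MDiffAt (T% X) x) (hY : MDiffAt (T% Y) x) :
    TensorialAt I E (fun Z ↦ koszul X Y Z x) x where
  smul {f Z} hf hZ := by
    have h1 : (fun y ↦ inner ℝ (Y y) ((f • Z) y)) = f * fun y ↦ inner ℝ (Y y) (Z y) := by
      ext y; simp [inner_smul_right]
    have h2 : (fun y ↦ inner ℝ ((f • Z) y) (X y)) = f * fun y ↦ inner ℝ (Z y) (X y) := by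
      ext y; simp [inner_smul_left]
    simp only [koszul, h1, h2, mvfderiv_mul hf (mdifferentiableAt_inner hY hZ),
      mvfderiv_mul hf (mdifferentiableAt_inner hZ hX),
      VectorField.mlieBracket_smul_left hf hZ, VectorField.mlieBracket_smul_right hf hZ]
    simp [inner_add_right, inner_smul_right, inner_smul_left, real_inner_comm]
    ring
  add {Z Z'} hZ hZ' := by
    have h1 : (fun y ↦ inner ℝ (Y y) ((Z + Z') y))
        = (fun y ↦ inner ℝ (Y y) (Z y)) + fun y ↦ inner ℝ (Y y) (Z' y) := by
      ext y; simp [inner_add_right]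
    have h2 : (fun y ↦ inner ℝ ((Z + Z') y) (X y))
        = (fun y ↦ inner ℝ (Z y) (X y)) + fun y ↦ inner ℝ (Z' y) (X y) := by
      ext y; simp [inner_add_left]
    simp only [koszul, h1, h2, mvfderiv_add (mdifferentiableAt_inner hY hZ) (mdifferentiableAt_inner hY hZ'),
      mvfderiv_add (mdifferentiableAt_inner hZ hX) (mdifferentiableAt_inner hZ' hX),
      VectorField.mlieBracket_add_left hZ hZ', VectorField.mlieBracket_add_right hZ hZ']
    simp [inner_add_right, inner_add_left]
    ring

theorem koszul_add_middle {X Y Y' Z : Π x : M, TangentSpace I x} {x : M}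
    (hX : MDiffAt (T% X) x) (hY : MDiffAt (T% Y) x) (hY' : MDiffAt (T% Y') x)
    (hZ : MDiffAt (T% Z) x) :
    koszul X (Y + Y') Z x = koszul X Y Z x + koszul X Y' Z x := by
  have h1 : (fun y ↦ inner ℝ ((Y + Y') y) (Z y))
      = (fun y ↦ inner ℝ (Y y) (Z y)) + fun y ↦ inner ℝ (Y' y) (Z y) := by
    ext y; simp [inner_add_left]
  have h2 : (fun y ↦ inner ℝ (X y) ((Y + Y') y))
      = (fun y ↦ inner ℝ (X y) (Y y)) + fun y ↦ inner ℝ (X y) (Y' y) := by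
    ext y; simp [inner_add_right]
  simp only [koszul, h1, h2, mvfderiv_add (mdifferentiableAt_inner hY hZ) (mdifferentiableAt_inner hY' hZ),
    mvfderiv_add (mdifferentiableAt_inner hX hY) (mdifferentiableAt_inner hX hY'),
    VectorField.mlieBracket_add_left hY hY', VectorField.mlieBracket_add_right hY hY']
  simp [inner_add_right, inner_add_left]
  ring

theorem koszul_smul_middle {X Y Z : Π x : M, TangentSpace I x} {f : M → ℝ} {x : M}
    (hf : MDiffAt f x)
    (hX : MDiffAt (T% X) x) (hY : MDiffAt (T% Y) x) (hZ : MDiffAt (T% Z) x) :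
    koszul X (f • Y) Z x
      = f x * koszul X Y Z x + 2 * (mvfderiv I f x (X x) * inner ℝ (Y x) (Z x)) := by
  have h1 : (fun y ↦ inner ℝ ((f • Y) y) (Z y)) = f * fun y ↦ inner ℝ (Y y) (Z y) := by
    ext y; simp [inner_smul_left]
  have h2 : (fun y ↦ inner ℝ (X y) ((f • Y) y)) = f * fun y ↦ inner ℝ (X y) (Y y) := by
    ext y; simp [inner_smul_right]
  simp only [koszul, h1, h2, mvfderiv_mul hf (mdifferentiableAt_inner hY hZ),
    mvfderiv_mul hf (mdifferentiableAt_inner hX hY),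
    VectorField.mlieBracket_smul_left hf hY, VectorField.mlieBracket_smul_right hf hY]
  simp [inner_add_right, inner_smul_right, inner_smul_left, real_inner_comm]
  ring

/-- `½ koszul`, as a bilinear form in the values of `X` and `Z` at `x`, for fixed `Y`. -/
def koszulForm (Y : Π x : M, TangentSpace I x) (x : M) (hY : MDiffAt (T% Y) x) :
    TangentSpace I x →L[ℝ] TangentSpace I x →L[ℝ] ℝ :=
  (2⁻¹ : ℝ) • TensorialAt.mkHom₂ (fun X Z ↦ koszul X Y Z x) x
    (fun _ hZ ↦ koszul_tensorial_left hY hZ) (fun _ hX ↦ koszul_tensorial_right hX hY)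

theorem koszulForm_apply {X Y Z : Π x : M, TangentSpace I x} {x : M}
    (hX : MDiffAt (T% X) x) (hY : MDiffAt (T% Y) x) (hZ : MDiffAt (T% Z) x) :
    koszulForm Y x hY (X x) (Z x) = 2⁻¹ * koszul X Y Z x := by
  have := TensorialAt.mkHom₂_apply (Φ := fun X Z ↦ koszul X Y Z x) (x := x)
    (fun _ hZ ↦ koszul_tensorial_left hY hZ) (fun _ hX ↦ koszul_tensorial_right hX hY) hX hZ
  simp [koszulForm, this]

instance instFiniteDimensionalTangentSpace (x : M) : FiniteDimensional ℝ (TangentSpace I x) :=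
  inferInstanceAs (FiniteDimensional ℝ E)

instance instCompleteSpaceTangentSpace (x : M) : CompleteSpace (TangentSpace I x) :=
  FiniteDimensional.complete ℝ (TangentSpace I x)

open scoped Classical in
/-- `u ↦ ∇_u Y` at `x`: the vector with `2 g(∇_u Y, w) = koszul u Y w`. (For a field `Y` that is not
differentiable at `x` the value is the junk value `0`.) -/
def leviCivitaFun (Y : Π x : M, TangentSpace I x) (x : M) :
    TangentSpace I x →L[ℝ] TangentSpace I x :=
  if hY : MDiffAt (T% Y) x then
    LinearMap.toContinuousLinearMap
      { toFun := fun u ↦ (InnerProductSpace.toDual ℝ (TangentSpace I x)).symm (koszulForm Y x hY u)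
        map_add' := by intro u v; simp
        map_smul' := by intro c u; simp }
  else 0

theorem inner_leviCivitaFun {Y : Π x : M, TangentSpace I x} {x : M}
    (hY : MDiffAt (T% Y) x) (u w : TangentSpace I x) :
    inner ℝ (leviCivitaFun Y x u) w = koszulForm Y x hY u w := by
  rw [leviCivitaFun, dif_pos hY]
  simp

theorem inner_leviCivitaFun_eq {X Y Z : Π x : M, TangentSpace I x} {x : M}
    (hX : MDiffAt (T% X) x) (hY : MDiffAt (T% Y) x) (hZ : MDiffAt (T% Z) x) :
    inner ℝ (leviCivitaFun Y x (X x)) (Z x) = 2⁻¹ * koszul X Y Z x := by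
  rw [inner_leviCivitaFun hY, koszulForm_apply hX hY hZ]

theorem leviCivitaFun_eq_of {Y : Π x : M, TangentSpace I x} {x : M} (hY : MDiffAt (T% Y) x)
    {L : TangentSpace I x →L[ℝ] TangentSpace I x}
    (h : ∀ X Z : Π x : M, TangentSpace I x, MDiffAt (T% X) x → MDiffAt (T% Z) x →
      inner ℝ (L (X x)) (Z x) = 2⁻¹ * koszul X Y Z x) :
    leviCivitaFun Y x = L := by
  ext1 u
  refine ext_inner_right ℝ fun w ↦ ?_
  have hu := FiberBundle.mdifferentiableAt_extend I E u
  have hw := FiberBundle.mdifferentiableAt_extend I E w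
  have h1 := h _ _ hu hw
  rw [← inner_leviCivitaFun_eq hu hY hw] at h1
  simpa using h1.symm

variable (I M) in
/-- The Levi-Civita connection of the Riemannian metric, given by the Koszul formula. -/
def leviCivita : CovariantDerivative I E (TangentSpace I : M → Type _) where
  toFun := leviCivitaFun
  isCovariantDerivativeOnUniv :=
    { add := by
        intro Y Y' x hY hY' _
        refine leviCivitaFun_eq_of (mdifferentiableAt_add_section hY hY') fun X Z hX hZ ↦ ?_
        rw [koszul_add_middle hX hY hY' hZ]
        simp [inner_add_left, inner_leviCivitaFun_eq hX hY hZ, inner_leviCivitaFun_eq hX hY' hZ]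
        ring
      leibniz := by
        intro Y f x hY hf _
        refine leviCivitaFun_eq_of (hf.smul_section hY) fun X Z hX hZ ↦ ?_
        rw [koszul_smul_middle hf hX hY hZ]
        simp [inner_add_left, inner_smul_left, inner_leviCivitaFun_eq hX hY hZ]
        ring }

theorem inner_leviCivita {X Y Z : Π x : M, TangentSpace I x} {x : M}
    (hX : MDiffAt (T% X) x) (hY : MDiffAt (T% Y) x) (hZ : MDiffAt (T% Z) x) :
    2 * inner ℝ (leviCivita I M Y x (X x)) (Z x) = koszul X Y Z x := by
  have := inner_leviCivitaFun_eq hX hY hZ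
  change 2 * inner ℝ (leviCivitaFun Y x (X x)) (Z x) = _
  rw [this]; ring

theorem leviCivita_torsion : (leviCivita I M).torsion = 0 := by
  rw [CovariantDerivative.torsion_eq_zero_iff]
  intro X Y x hX hY
  refine ext_inner_right ℝ fun w ↦ ?_
  have hw := FiberBundle.mdifferentiableAt_extend I E w
  have h1 := inner_leviCivita hX hY hw
  have h2 := inner_leviCivita hY hX hw
  simp only [FiberBundle.extend_apply_self] at h1 h2
  rw [inner_sub_left]
  rw [koszul, VectorField.mlieBracket_swap_apply (V := Y) (W := FiberBundle.extend E w)] at h1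
  rw [koszul, VectorField.mlieBracket_swap_apply (V := X) (W := FiberBundle.extend E w),
    VectorField.mlieBracket_swap_apply (V := Y) (W := X)] at h2
  simp only [FiberBundle.extend_apply_self, inner_neg_right, real_inner_comm] at h1 h2 ⊢
  linarith

theorem leviCivita_metric {X Y Z : Π x : M, TangentSpace I x} {x : M}
    (hX : MDiffAt (T% X) x) (hY : MDiffAt (T% Y) x) (hZ : MDiffAt (T% Z) x) :
    mvfderiv I (fun y ↦ inner ℝ (Y y) (Z y)) x (X x)
      = inner ℝ (leviCivita I M Y x (X x)) (Z x) + inner ℝ (Y x) (leviCivita I M Z x (X x)) := by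
  have h1 := inner_leviCivita hX hY hZ
  have h2 := inner_leviCivita hX hZ hY
  rw [koszul, VectorField.mlieBracket_swap_apply (V := Y) (W := Z),
    VectorField.mlieBracket_swap_apply (V := Z) (W := X)] at h1
  rw [koszul, VectorField.mlieBracket_swap_apply (V := Y) (W := X)] at h2
  simp only [inner_neg_right, real_inner_comm] at h1 h2 ⊢
  linarith

/-- The curvature `R(X,Y)Z = ∇_X ∇_Y Z - ∇_Y ∇_X Z - ∇_[X,Y] Z` of the Levi-Civita connection.
(`leviCivita I M Z x u` is `∇_u Z` at `x`.) -/
def curvature (X Y Z : Π x : M, TangentSpace I x) (x : M) : TangentSpace I x :=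
  leviCivita I M (fun y ↦ leviCivita I M Z y (Y y)) x (X x)
    - leviCivita I M (fun y ↦ leviCivita I M Z y (X y)) x (Y x)
    - leviCivita I M Z x (VectorField.mlieBracket I X Y x)

/-- The Ricci tensor `S(Y,Z)`: the trace of `u ↦ R(u,Y)Z` on the tangent space at `x`, computed in an
orthonormal basis `e` of that tangent space. To apply the curvature of vector fields, `e i` is
extended to a vector field that is smooth near `x`; `R(X,Y)Z` at `x` depends on `X` only through
its value at `x`. -/
def ricci (Y Z : Π x : M, TangentSpace I x) (x : M) : ℝ :=
  let e := stdOrthonormalBasis ℝ (TangentSpace I x)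
  ∑ i, inner ℝ (curvature (FiberBundle.extend E (e i)) Y Z x) (e i)

/-- The Lie derivative of the metric: `(L_V g)(X,Y) = V g(X,Y) - g([V,X],Y) - g(X,[V,Y])`. -/
def lieDerivMetric (V X Y : Π x : M, TangentSpace I x) (x : M) : ℝ :=
  mvfderiv I (fun y ↦ inner ℝ (X y) (Y y)) x (V x)
    - inner ℝ (VectorField.mlieBracket I V X x) (Y x)
    - inner ℝ (X x) (VectorField.mlieBracket I V Y x)

/-- The Lie derivative of a 1-form: `(L_V η)(X) = V (η X) - η [V,X]`. -/
def lieDerivOneForm (V : Π x : M, TangentSpace I x) (η : Π x : M, TangentSpace I x →L[ℝ] ℝ)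
    (X : Π x : M, TangentSpace I x) (x : M) : ℝ :=
  mvfderiv I (fun y ↦ η y (X y)) x (V x) - η x (VectorField.mlieBracket I V X x)

/-- The Lie derivative of a vector field: `L_V X = [V,X]`. -/
def lieDerivVectorField (V X : Π x : M, TangentSpace I x) (x : M) : TangentSpace I x :=
  VectorField.mlieBracket I V X x

/-- A smooth vector field. -/
def IsSmoothVectorField (X : Π x : M, TangentSpace I x) : Prop :=
  ContMDiff I I.tangent ∞ (fun x ↦ (⟨x, X x⟩ : TangentBundle I M))

variable (I M) in
/-- An almost contact metric structure `(φ, ξ, η)` on a Riemannian manifold, the metric being the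
inner product on the tangent spaces. -/
structure AlmostContactMetricStructure where
  /-- the `(1,1)`-tensor field `φ` -/
  φ : Π x : M, TangentSpace I x →L[ℝ] TangentSpace I x
  /-- the characteristic vector field `ξ` -/
  ξ : Π x : M, TangentSpace I x
  /-- the 1-form `η` -/
  η : Π x : M, TangentSpace I x →L[ℝ] ℝ
  contMDiff_φ : ContMDiff I (I.prod 𝓘(ℝ, E →L[ℝ] E)) ∞
    (fun x ↦ TotalSpace.mk' (E →L[ℝ] E) (E := fun x : M ↦ TangentSpace I x →L[ℝ] TangentSpace I x)
      x (φ x))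
  contMDiff_ξ : IsSmoothVectorField ξ
  contMDiff_η : ContMDiff I (I.prod 𝓘(ℝ, E →L[ℝ] ℝ)) ∞
    (fun x ↦ TotalSpace.mk' (E →L[ℝ] ℝ) (E := fun x : M ↦ TangentSpace I x →L[ℝ] ℝ) x (η x))
  φ_φ : ∀ (x : M) (u : TangentSpace I x), φ x (φ x u) = -u + η x u • ξ x
  η_ξ : ∀ x : M, η x (ξ x) = 1
  η_eq : ∀ (x : M) (u : TangentSpace I x), η x u = inner ℝ u (ξ x)
  inner_φ_φ : ∀ (x : M) (u v : TangentSpace I x),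
    inner ℝ (φ x u) (φ x v) = inner ℝ u v - η x u * η x v

namespace AlmostContactMetricStructure

/-- The Kenmotsu condition `(∇_u φ) Y = g(φ u, Y) ξ - η(Y) φ u` for all tangent vectors `u` and all
smooth vector fields `Y`, where `(∇_u φ) Y = ∇_u (φ Y) - φ (∇_u Y)` and `∇` is the Levi-Civita
connection. (`(∇_X φ) Y` at `x` depends on the field `X` only through `u = X x`.) -/
def IsKenmotsu (A : AlmostContactMetricStructure I M) : Prop :=
  ∀ Y : Π x : M, TangentSpace I x, IsSmoothVectorField Y → ∀ (x : M) (u : TangentSpace I x),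
    leviCivita I M (fun y ↦ A.φ y (Y y)) x u - A.φ x (leviCivita I M Y x u)
      = inner ℝ (A.φ x u) (Y x) • A.ξ x - A.η x (Y x) • A.φ x u

/-- `(g, V, λ, μ)` is a conformal η-Ricci soliton with conformal pressure `p`:
`L_V g + 2 S + [2 λ - (p + 2 / N)] g + 2 μ η ⊗ η = 0`, where `N` is the dimension of the manifold
(the dimension of its model space `E`). -/
def IsConformalEtaRicciSoliton (A : AlmostContactMetricStructure I M)
    (V : Π x : M, TangentSpace I x) (lam mu : ℝ) (p : M → ℝ) : Prop :=
  IsSmoothVectorField V ∧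
  ∀ X Y : Π x : M, TangentSpace I x, IsSmoothVectorField X → IsSmoothVectorField Y → ∀ x : M,
    lieDerivMetric V X Y x + 2 * ricci X Y x
      + (2 * lam - (p x + 2 / (Module.finrank ℝ E : ℝ))) * inner ℝ (X x) (Y x)
      + 2 * mu * (A.η x (X x) * A.η x (Y x)) = 0

end AlmostContactMetricStructure

end RiemannianGeometry
end

open RiemannianGeometry

namespace RiemannianGeometry

variable {E : Type*} [NormedAddCommGroup E] [NormedSpace ℝ E] [FiniteDimensional ℝ E]
  {H : Type*} [TopologicalSpace H] {I : ModelWithCorners ℝ E H}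
  {M : Type*} [TopologicalSpace M] [ChartedSpace H M] [IsManifold I ∞ M]
  [RiemannianBundle (fun x : M ↦ TangentSpace I x)]
  [IsContMDiffRiemannianBundle I ∞ E (fun x : M ↦ TangentSpace I x)]

theorem IsSmoothVectorField.mdiffAt {X : Π x : M, TangentSpace I x} (hX : IsSmoothVectorField X)
    (x : M) : MDiffAt (T% X) x :=
  (hX x).mdifferentiableAt (by simp)

/-- The Levi-Civita connection is metric, with the direction of differentiation given by a tangent
vector. -/
theorem mvfderiv_inner_eq_leviCivita {Y Z : Π x : M, TangentSpace I x} {x : M}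
    (hY : MDiffAt (T% Y) x) (hZ : MDiffAt (T% Z) x) (u : TangentSpace I x) :
    mvfderiv I (fun y ↦ inner ℝ (Y y) (Z y)) x u
      = inner ℝ (leviCivita I M Y x u) (Z x) + inner ℝ (Y x) (leviCivita I M Z x u) := by
  simpa using leviCivita_metric (FiberBundle.mdifferentiableAt_extend I E u) hY hZ

/-- The Levi-Civita connection is torsion free: `∇_X Y - ∇_Y X = [X,Y]`. -/
theorem leviCivita_sub_leviCivita {X Y : Π x : M, TangentSpace I x} {x : M}
    (hX : MDiffAt (T% X) x) (hY : MDiffAt (T% Y) x) :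
    leviCivita I M Y x (X x) - leviCivita I M X x (Y x) = VectorField.mlieBracket I X Y x :=
  (CovariantDerivative.torsion_eq_zero_iff (cov := leviCivita I M)).1 leviCivita_torsion hX hY

namespace AlmostContactMetricStructure

variable (A : AlmostContactMetricStructure I M)

theorem inner_ξ_ξ (x : M) : inner ℝ (A.ξ x) (A.ξ x) = (1 : ℝ) := by
  rw [← A.η_eq, A.η_ξ]

theorem φ_ξ (x : M) : A.φ x (A.ξ x) = 0 := by
  have h := A.inner_φ_φ x (A.ξ x) (A.ξ x)
  rw [A.inner_ξ_ξ, A.η_ξ] at h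
  exact inner_self_eq_zero.1 (h.trans (by norm_num))

theorem η_φ (x : M) (u : TangentSpace I x) : A.η x (A.φ x u) = 0 := by
  have h := A.φ_φ x (A.φ x u)
  rw [A.φ_φ x u, map_add, map_neg, map_smul, A.φ_ξ, smul_zero, add_zero, left_eq_add] at h
  simpa [A.η_ξ] using congrArg (A.η x) h

theorem mdiffAt_ξ (x : M) : MDiffAt (T% A.ξ) x :=
  A.contMDiff_ξ.mdiffAt x

theorem η_comp_eq (X : Π x : M, TangentSpace I x) :
    (fun y ↦ A.η y (X y)) = fun y ↦ inner ℝ (X y) (A.ξ y) :=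
  funext fun y ↦ A.η_eq y (X y)

theorem mdiffAt_η_comp {X : Π x : M, TangentSpace I x} {x : M} (hX : MDiffAt (T% X) x) :
    MDiffAt (fun y ↦ A.η y (X y)) x := by
  rw [A.η_comp_eq]
  exact mdifferentiableAt_inner hX (A.mdiffAt_ξ x)

/-- As `ξ` is a unit field, `∇ξ` takes values in the kernel of `η`. -/
theorem η_leviCivita_ξ (x : M) (u : TangentSpace I x) :
    A.η x (leviCivita I M A.ξ x u) = 0 := by
  have h := mvfderiv_inner_eq_leviCivita (A.mdiffAt_ξ x) (A.mdiffAt_ξ x) u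
  simp only [A.inner_ξ_ξ, mvfderiv_const] at h
  rw [real_inner_comm (leviCivita I M A.ξ x u) (A.ξ x), ← A.η_eq] at h
  simp at h
  linarith

theorem lieDerivMetric_ξ (V X : Π x : M, TangentSpace I x) (x : M) :
    lieDerivMetric V X A.ξ x
      = lieDerivOneForm V A.η X x - inner ℝ (X x) (lieDerivVectorField V A.ξ x) := by
  rw [lieDerivMetric, lieDerivOneForm, A.η_comp_eq, A.η_eq, lieDerivVectorField]

theorem lieDerivOneForm_η_ξ (V : Π x : M, TangentSpace I x) (x : M) :
    lieDerivOneForm V A.η A.ξ x = -A.η x (lieDerivVectorField V A.ξ x) := by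
  simp [lieDerivOneForm, lieDerivVectorField, A.η_ξ, mvfderiv_const]

namespace IsKenmotsu

variable {A}

/-- On a Kenmotsu manifold `∇_u ξ = u - η(u) ξ`. -/
theorem leviCivita_ξ (hA : A.IsKenmotsu) (x : M) (u : TangentSpace I x) :
    leviCivita I M A.ξ x u = u - A.η x u • A.ξ x := by
  have h := hA A.ξ A.contMDiff_ξ x u
  have h0 : (fun y ↦ A.φ y (A.ξ y)) = (0 : Π x : M, TangentSpace I x) := funext A.φ_ξ
  rw [h0, CovariantDerivative.zero, ← A.η_eq, A.η_φ, A.η_ξ] at h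
  rw [Pi.zero_apply, _root_.zero_apply, zero_sub, zero_smul, one_smul, zero_sub, neg_inj] at h
  have h2 := congrArg (A.φ x) h
  rw [A.φ_φ, A.φ_φ, A.η_leviCivita_ξ, zero_smul, add_zero] at h2
  rw [← neg_inj, h2]
  abel

/-- `(∇_u η)(X) = g(X,u) - η(X) η(u)` on a Kenmotsu manifold. -/
theorem mvfderiv_η_comp (hA : A.IsKenmotsu) {X : Π x : M, TangentSpace I x} {x : M} (hX : MDiffAt (T% X) x)
    (u : TangentSpace I x) :
    mvfderiv I (fun y ↦ A.η y (X y)) x u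
      = A.η x (leviCivita I M X x u) + (inner ℝ (X x) u - A.η x u * A.η x (X x)) := by
  rw [A.η_comp_eq, mvfderiv_inner_eq_leviCivita hX (A.mdiffAt_ξ x), hA.leviCivita_ξ,
    inner_sub_right, inner_smul_right, ← A.η_eq, ← A.η_eq]

theorem leviCivita_leviCivita_ξ (hA : A.IsKenmotsu) {X : Π x : M, TangentSpace I x} {x : M} (hX : MDiffAt (T% X) x)
    (u : TangentSpace I x) :
    leviCivita I M (fun y ↦ leviCivita I M A.ξ y (X y)) x u
      = leviCivita I M X x u - A.η x (X x) • (u - A.η x u • A.ξ x)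
        - (A.η x (leviCivita I M X x u) + (inner ℝ (X x) u - A.η x u * A.η x (X x))) • A.ξ x := by
  have h0 : (fun y ↦ leviCivita I M A.ξ y (X y))
      = X + (-fun y ↦ A.η y (X y)) • A.ξ := by
    funext y
    simp [hA.leviCivita_ξ, sub_eq_add_neg]
  have hη := A.mdiffAt_η_comp hX
  have hη' : MDiffAt (-fun y ↦ A.η y (X y)) x := hη.neg
  have hcov := (leviCivita I M).isCovariantDerivativeOnUniv
  rw [h0, hcov.add hX (hη'.smul_section (A.mdiffAt_ξ x)), hcov.leibniz (A.mdiffAt_ξ x) hη',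
    mvfderiv_neg]
  simp [hA.leviCivita_ξ, hA.mvfderiv_η_comp hX]
  module

/-- On a Kenmotsu manifold `R(X,Y)ξ = η(X) Y - η(Y) X`. -/
theorem curvature_ξ (hA : A.IsKenmotsu) {X Y : Π x : M, TangentSpace I x} {x : M}
    (hX : MDiffAt (T% X) x) (hY : MDiffAt (T% Y) x) :
    curvature X Y A.ξ x = A.η x (X x) • Y x - A.η x (Y x) • X x := by
  rw [curvature, hA.leviCivita_leviCivita_ξ hX, hA.leviCivita_leviCivita_ξ hY, hA.leviCivita_ξ,
    ← leviCivita_sub_leviCivita hX hY, map_sub, real_inner_comm]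
  module

/-- On a Kenmotsu manifold of dimension `N`, `S(X,ξ) = -(N - 1) η(X)`. -/
theorem ricci_ξ (hA : A.IsKenmotsu) {X : Π x : M, TangentSpace I x} {x : M} (hX : MDiffAt (T% X) x) :
    ricci X A.ξ x = -((Module.finrank ℝ E : ℝ) - 1) * A.η x (X x) := by
  have hN : Module.finrank ℝ (TangentSpace I x) = Module.finrank ℝ E := rfl
  simp only [ricci]
  set e := stdOrthonormalBasis ℝ (TangentSpace I x)
  have h (i) : inner ℝ (curvature (FiberBundle.extend E (e i)) X A.ξ x) (e i)
      = inner ℝ (X x) (e i) * inner ℝ (e i) (A.ξ x) - A.η x (X x) := by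
    rw [hA.curvature_ξ (FiberBundle.mdifferentiableAt_extend I E (e i)) hX]
    simp [inner_sub_left, inner_smul_left, A.η_eq, mul_comm]
  rw [Finset.sum_congr rfl fun i _ ↦ h i, Finset.sum_sub_distrib, e.sum_inner_mul_inner,
    ← A.η_eq]
  simp [hN]
  ring

end IsKenmotsu

end AlmostContactMetricStructure

end RiemannianGeometry

theorem lie_derivative_eta_eq_of_conformal_eta_ricci_soliton
    {n : ℕ} {M : Type*} [TopologicalSpace M] [T2Space M] [SecondCountableTopology M]
    [ChartedSpace (EuclideanSpace ℝ (Fin (2 * n + 1))) M] [IsManifold (𝓡 (2 * n + 1)) ∞ M]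
    [RiemannianBundle (fun x : M ↦ TangentSpace (𝓡 (2 * n + 1)) x)]
    [IsContMDiffRiemannianBundle (𝓡 (2 * n + 1)) ∞ (EuclideanSpace ℝ (Fin (2 * n + 1)))
      (fun x : M ↦ TangentSpace (𝓡 (2 * n + 1)) x)]
    (A : AlmostContactMetricStructure (𝓡 (2 * n + 1)) M) (hA : A.IsKenmotsu)
    (V : Π x : M, TangentSpace (𝓡 (2 * n + 1)) x) (lam mu : ℝ) (p : M → ℝ)
    (hV : A.IsConformalEtaRicciSoliton V lam mu p)
    (hξ : ∀ x : M, lieDerivVectorField V A.ξ x = A.η x (lieDerivVectorField V A.ξ x) • A.ξ x)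
    (X : Π x : M, TangentSpace (𝓡 (2 * n + 1)) x) (hX : IsSmoothVectorField X) (x : M) :
    lieDerivOneForm V A.η X x
      = ((2 * (n : ℝ) - lam - mu) + (p x / 2 + 1 / (2 * (n : ℝ) + 1))) * A.η x (X x) := by
  have hN : (Module.finrank ℝ (EuclideanSpace ℝ (Fin (2 * n + 1))) : ℝ) = 2 * n + 1 := by simp
  have h (Y : Π x : M, TangentSpace (𝓡 (2 * n + 1)) x) (hY : IsSmoothVectorField Y) :
      lieDerivOneForm V A.η Y x - A.η x (lieDerivVectorField V A.ξ x) * A.η x (Y x)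
        = 2 * ((2 * (n : ℝ) - lam - mu) + (p x / 2 + 1 / (2 * (n : ℝ) + 1))) * A.η x (Y x) := by
    have h1 := hV.2 Y A.ξ hY A.contMDiff_ξ x
    rw [A.lieDerivMetric_ξ, hξ x, inner_smul_right, ← A.η_eq, hA.ricci_ξ (hY.mdiffAt x), A.η_ξ,
      hN] at h1
    linear_combination h1
  have h1 := h A.ξ A.contMDiff_ξ
  rw [A.lieDerivOneForm_η_ξ, A.η_ξ] at h1
  linear_combination h X hX - A.η x (X x) / 2 * h1
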